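/- arXiv:2412.05754 — 3 statements merged into one kernel-verified Lean document; each statement's English description precedes it below -/
import Mathlib

section
/- Let G be a simple graph on a vertex type V with a weight function w : V → V → ℝ≥0∞ assigned to its edges, and fix a source s ∈ V. Then the weighted distance satisfies the Bellman optimality equation: for every v ∈ V with v ≠ s, wdist(s, v) = ⨅_{u adjacent to v} ( wdist(s, u) + w(u, v) ), where the infimum over the empty set is ∞. -/
open scoped ENNReal

/-- The cost of a walk: the sum of the edge weights `w` over its consecutive edges. -/
noncomputable def walkCost {V : Type*} {G : SimpleGraph V} (w : V → V → ℝ≥0∞)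
    {u v : V} (p : G.Walk u v) : ℝ≥0∞ :=
  (p.darts.map fun d => w d.fst d.snd).sum

/-- The weighted distance: the infimum of walk costs over all walks from `u` to `v`
(`∞` if no walk exists). -/
noncomputable def wdist {V : Type*} (G : SimpleGraph V) (w : V → V → ℝ≥0∞)
    (u v : V) : ℝ≥0∞ :=
  ⨅ p : G.Walk u v, walkCost w p

theorem walkCost_concat {V : Type*} {G : SimpleGraph V} (w : V → V → ℝ≥0∞) {u v x : V}
    (p : G.Walk u v) (h : G.Adj v x) :
    walkCost w (p.concat h) = walkCost w p + w v x := by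
  simp [walkCost, SimpleGraph.Walk.darts_concat]

theorem wdist_le_walkCost {V : Type*} {G : SimpleGraph V} (w : V → V → ℝ≥0∞) {u v : V}
    (p : G.Walk u v) : wdist G w u v ≤ walkCost w p :=
  iInf_le _ p

theorem wdist_bellman {V : Type*} (G : SimpleGraph V) (w : V → V → ℝ≥0∞) (s : V) :
    ∀ v : V, v ≠ s →
      wdist G w s v = ⨅ u : {u : V // G.Adj u v}, (wdist G w s u + w u v) := by
  intro v hv
  apply le_antisymm
  · refine le_iInf fun u => ?_
    rw [wdist, wdist, ENNReal.iInf_add]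
    exact le_iInf fun p => (iInf_le _ (p.concat u.2)).trans_eq (walkCost_concat w p u.2)
  · refine le_iInf fun p => ?_
    cases p with
    | nil => exact absurd rfl hv
    | cons h p =>
      obtain ⟨u, q, hu, hq⟩ := SimpleGraph.Walk.exists_cons_eq_concat h p
      rw [hq, walkCost_concat]
      exact (iInf_le _ (⟨u, hu⟩ : {u : V // G.Adj u v})).trans
        (add_le_add_left (wdist_le_walkCost w q) _)
end

section
/- Let G be a simple graph on a vertex type V with a weight function w : V → V → ℝ≥0∞ assigned to its edges, fix a source s ∈ V, and let S ⊆ V be a set with s ∈ S such that for every u ∈ S a label D(u) is given with D(u) = wdist(s, u). For v ∉ S define key(v) = ⨅_{u ∈ S, u adjacent to v} ( D(u) + w(u, v) ). If v* ∉ S satisfies key(v*) ≤ key(v) for all v ∉ S, and moreover wdist(s, x) ≥ wdist(s, u) for every x ∉ S and u ∈ S is not required but every walk from s to any vertex outside S must cross an edge from S to its complement, then key(v*) = wdist(s, v*). -/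
open scoped ENNReal

theorem walkCost_append {V : Type*} {G : SimpleGraph V} (w : V → V → ℝ≥0∞) {u v x : V}
    (p : G.Walk u v) (q : G.Walk v x) :
    walkCost w (p.append q) = walkCost w p + walkCost w q := by
  simp [walkCost]

theorem wdist_self {V : Type*} (G : SimpleGraph V) (w : V → V → ℝ≥0∞) (u : V) :
    wdist G w u u = 0 :=
  nonpos_iff_eq_zero.mp <| by
    simpa [walkCost] using wdist_le_walkCost w (SimpleGraph.Walk.nil : G.Walk u u)

theorem wdist_le_of_adj {V : Type*} {G : SimpleGraph V} (w : V → V → ℝ≥0∞) {u v : V}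
    (h : G.Adj u v) : wdist G w u v ≤ w u v := by
  simpa [walkCost] using wdist_le_walkCost w h.toWalk

theorem wdist_triangle {V : Type*} (G : SimpleGraph V) (w : V → V → ℝ≥0∞) (u v x : V) :
    wdist G w u x ≤ wdist G w u v + wdist G w v x :=
  ENNReal.le_iInf_add_iInf fun p q =>
    (wdist_le_walkCost w (p.append q)).trans_eq (walkCost_append w p q)

/-- A walk costs at least the distance to any of its darts plus the weight of that dart. -/
theorem wdist_add_le_walkCost {V : Type*} {G : SimpleGraph V} (w : V → V → ℝ≥0∞) {u v : V}
    (p : G.Walk u v) {d : G.Dart} (hd : d ∈ p.darts) :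
    wdist G w u d.fst + w d.fst d.snd ≤ walkCost w p := by
  induction p with
  | nil => simp at hd
  | @cons a b c h q ih =>
    have hcost : walkCost w (SimpleGraph.Walk.cons h q) = w a b + walkCost w q := by
      simp [walkCost]
    rw [hcost]
    rcases List.mem_cons.mp (SimpleGraph.Walk.darts_cons h q ▸ hd) with rfl | hd
    · simp [wdist_self]
    · calc wdist G w a d.fst + w d.fst d.snd
          ≤ w a b + wdist G w b d.fst + w d.fst d.snd := by
            gcongr
            exact (wdist_triangle G w a b d.fst).trans (by gcongr; exact wdist_le_of_adj w h)
        _ ≤ w a b + walkCost w q := by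
            rw [add_assoc]
            gcongr
            exact ih hd

theorem dijkstra_frontier_invariant {V : Type*} (G : SimpleGraph V)
    (w : V → V → ℝ≥0∞) (s : V) (S : Set V) (hs : s ∈ S)
    (D : V → ℝ≥0∞) (hD : ∀ u ∈ S, D u = wdist G w s u)
    (key : V → ℝ≥0∞)
    (hkey : ∀ v : V, key v = ⨅ u : {u : V // u ∈ S ∧ G.Adj u v}, (D u + w u v))
    (vstar : V) (hvstar : vstar ∉ S)
    (hmin : ∀ v : V, v ∉ S → key vstar ≤ key v)
    (hcross : ∀ x : V, x ∉ S → ∀ p : G.Walk s x,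
      ∃ d ∈ p.darts, d.fst ∈ S ∧ d.snd ∉ S) :
    key vstar = wdist G w s vstar := by
  apply le_antisymm
  · refine le_iInf fun p => ?_
    obtain ⟨d, hd, hfst, hsnd⟩ := hcross vstar hvstar p
    calc key vstar ≤ key d.snd := hmin _ hsnd
      _ ≤ D d.fst + w d.fst d.snd := by
        rw [hkey]
        exact iInf_le (fun u : {u : V // u ∈ S ∧ G.Adj u d.snd} => D u + w u d.snd)
          ⟨d.fst, hfst, d.adj⟩
      _ ≤ walkCost w p := by
        rw [hD _ hfst]
        exact wdist_add_le_walkCost w p hd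
  · rw [hkey]
    refine le_iInf fun ⟨u, hu, hadj⟩ => ?_
    rw [hD u hu]
    exact (wdist_triangle G w s u vstar).trans (by gcongr; exact wdist_le_of_adj w hadj)
end

section
/- Let G be a simple graph on a vertex type V with a weight function w : V → V → ℝ≥0∞ assigned to its edges, let φ : V → EuclideanSpace ℝ (Fin n) satisfy w(u, v) ≥ ‖φ(u) − φ(v)‖ for every edge (u, v), and fix s, g ∈ V and a bound C ∈ ℝ≥0∞. If a walk from s to g has cost at most C and passes through a vertex x, then ‖φ(s) − φ(x)‖ + ‖φ(x) − φ(g)‖ ≤ C. Consequently any vertex x with ‖φ(s) − φ(x)‖ + ‖φ(x) − φ(g)‖ > C lies on no walk from s to g of cost at most C and may be pruned without loss. -/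
open scoped ENNReal

/-- If every edge weighs at least the distance between the images of its endpoints, then every
walk costs at least the distance between the images of its endpoints. -/
theorem edist_le_walkCost {V E : Type*} [PseudoEMetricSpace E] {G : SimpleGraph V}
    {w : V → V → ℝ≥0∞} {φ : V → E} (hw : ∀ u v : V, G.Adj u v → edist (φ u) (φ v) ≤ w u v)
    {u v : V} (p : G.Walk u v) : edist (φ u) (φ v) ≤ walkCost w p := by
  induction p with
  | nil => simp
  | @cons u x v h p ih =>
    calc edist (φ u) (φ v) ≤ edist (φ u) (φ x) + edist (φ x) (φ v) := edist_triangle _ _ _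
      _ ≤ w u x + walkCost w p := add_le_add (hw u x h) ih
      _ = walkCost w (.cons h p) := by simp [walkCost]

theorem informed_set_prunes_nothing {V : Type*} (G : SimpleGraph V)
    (w : V → V → ℝ≥0∞) {n : ℕ} (φ : V → EuclideanSpace ℝ (Fin n))
    (hw : ∀ u v : V, G.Adj u v → (‖φ u - φ v‖₊ : ℝ≥0∞) ≤ w u v)
    (s g : V) (C : ℝ≥0∞) :
    ∀ p : G.Walk s g, walkCost w p ≤ C →
      ∀ x ∈ p.support, (‖φ s - φ x‖₊ : ℝ≥0∞) + (‖φ x - φ g‖₊ : ℝ≥0∞) ≤ C := by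
  intro p hp x hx
  obtain ⟨q, r, rfl⟩ := SimpleGraph.Walk.mem_support_iff_exists_append.mp hx
  rw [walkCost_append] at hp
  simp only [← enorm_eq_nnnorm, ← edist_eq_enorm_sub] at hw ⊢
  exact (add_le_add (edist_le_walkCost hw q) (edist_le_walkCost hw r)).trans hp
end
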